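/- Let μ be a probability measure on a measurable space V and f : ℝⁿ × V → ℝⁿ a measurable map that is for each v polynomial in x. Let X₀ = { x ∈ ℝⁿ : g₀(x) ≥ 0 }, X₁ = { x ∈ ℝⁿ : g₁(x) ≥ 0 }, and X = { x ∈ ℝⁿ : g(x) ≥ 0 }, where g₀, g₁, g are finite vectors of real polynomials in n variables and the inequalities are componentwise. Let B be a real polynomial in n variables that is a sum of squares, let γ ∈ [0,1] and c ≥ 0 be constants, let h be a real polynomial in n variables with h(x) = ∫_V B(f(x, v)) dμ(v) for all x ∈ ℝⁿ, and let λ₀, λ₁, λ be vectors of sum-of-squares polynomials of the same lengths as g₀, g₁, g respectively. If the three polynomials (i) −B − λ₀ᵀ g₀ + γ, (ii) B − λ₁ᵀ g₁ − 1, and (iii) −h + B − λᵀ g + c are each sums of squares of polynomials, then B satisfies: B(x) ≤ γ for all x ∈ X₀; B(x) ≥ 1 for all x ∈ X₁; and ∫_V B(f(x, v)) dμ(v) ≤ B(x) + c for all x ∈ X (i.e., B is a nonnegative c-martingale barrier certificate in the sense of Theorem 1 on X). -/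

import Mathlib

open MvPolynomial MeasureTheory

/-- A real multivariate polynomial is a sum of squares if it is a finite sum of
squares of polynomials. -/
def IsSumOfSquares {n : ℕ} (p : MvPolynomial (Fin n) ℝ) : Prop :=
  ∃ (k : ℕ) (q : Fin k → MvPolynomial (Fin n) ℝ), p = ∑ j, (q j) ^ 2

theorem IsSumOfSquares.eval_nonneg {n : ℕ} {p : MvPolynomial (Fin n) ℝ}
    (hp : IsSumOfSquares p) (x : Fin n → ℝ) : 0 ≤ eval x p := by
  obtain ⟨k, q, rfl⟩ := hp
  simp only [map_sum, map_pow]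
  exact Finset.sum_nonneg fun j _ => sq_nonneg _

theorem eval_sum_mul_nonneg {n m : ℕ} {l g : Fin m → MvPolynomial (Fin n) ℝ}
    (hl : ∀ j, IsSumOfSquares (l j)) {x : Fin n → ℝ} (hg : ∀ j, 0 ≤ eval x (g j)) :
    0 ≤ eval x (∑ j, l j * g j) := by
  simp only [map_sum, map_mul]
  exact Finset.sum_nonneg fun j _ => mul_nonneg ((hl j).eval_nonneg x) (hg j)

/-- **Lemma 3 (SOS barrier certificate).**  Let `X₀ = {g₀ ≥ 0}`, `X₁ = {g₁ ≥ 0}`,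
`X = {g ≥ 0}` be semi-algebraic sets given by vectors of polynomials, `B` an SOS
polynomial, `γ ∈ [0,1]`, `c ≥ 0`, and `h` the polynomial representing
`x ↦ ∫ B(f(x,v)) dμ(v)`.  If `λ₀, λ₁, λ` are vectors of SOS polynomials and the
three polynomials `-B - λ₀ᵀg₀ + γ`, `B - λ₁ᵀg₁ - 1`, `-h + B - λᵀg + c` are SOS,
then `B` is a nonnegative barrier certificate: `B ≤ γ` on `X₀`, `B ≥ 1` on `X₁`,
and `∫ B(f(x,v)) dμ(v) ≤ B(x) + c` on `X`. -/
theorem sos_barrier_certificate {n m₀ m₁ m₂ : ℕ}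
    {V : Type*} [MeasurableSpace V] (μ : Measure V) [IsProbabilityMeasure μ]
    (f : (Fin n → ℝ) → V → (Fin n → ℝ))
    (hf : Measurable fun p : (Fin n → ℝ) × V => f p.1 p.2)
    (hf_poly : ∀ v : V, ∃ p : Fin n → MvPolynomial (Fin n) ℝ,
      ∀ (x : Fin n → ℝ) (i : Fin n), f x v i = eval x (p i))
    (g₀ : Fin m₀ → MvPolynomial (Fin n) ℝ)
    (g₁ : Fin m₁ → MvPolynomial (Fin n) ℝ)
    (g : Fin m₂ → MvPolynomial (Fin n) ℝ)
    (B h : MvPolynomial (Fin n) ℝ)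
    (hB : IsSumOfSquares B)
    (γ c : ℝ) (hγ0 : 0 ≤ γ) (hγ1 : γ ≤ 1) (hc : 0 ≤ c)
    (hh : ∀ x : Fin n → ℝ, eval x h = ∫ v, eval (f x v) B ∂μ)
    (lam₀ : Fin m₀ → MvPolynomial (Fin n) ℝ)
    (lam₁ : Fin m₁ → MvPolynomial (Fin n) ℝ)
    (lam : Fin m₂ → MvPolynomial (Fin n) ℝ)
    (hlam₀ : ∀ j, IsSumOfSquares (lam₀ j))
    (hlam₁ : ∀ j, IsSumOfSquares (lam₁ j))
    (hlam : ∀ j, IsSumOfSquares (lam j))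
    (hsos₀ : IsSumOfSquares (-B - (∑ j, lam₀ j * g₀ j) + C γ))
    (hsos₁ : IsSumOfSquares (B - (∑ j, lam₁ j * g₁ j) - 1))
    (hsos₂ : IsSumOfSquares (-h + B - (∑ j, lam j * g j) + C c)) :
    (∀ x : Fin n → ℝ, 0 ≤ eval x B) ∧
    (∀ x : Fin n → ℝ, (∀ j, 0 ≤ eval x (g₀ j)) → eval x B ≤ γ) ∧
    (∀ x : Fin n → ℝ, (∀ j, 0 ≤ eval x (g₁ j)) → 1 ≤ eval x B) ∧
    (∀ x : Fin n → ℝ, (∀ j, 0 ≤ eval x (g j)) →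
      ∫ v, eval (f x v) B ∂μ ≤ eval x B + c) := by
  refine ⟨hB.eval_nonneg, fun x hx => ?_, fun x hx => ?_, fun x hx => ?_⟩
  · have h₁ := hsos₀.eval_nonneg x
    have h₂ := eval_sum_mul_nonneg hlam₀ hx
    rw [map_add, map_sub, map_neg, eval_C] at h₁
    linarith
  · have h₁ := hsos₁.eval_nonneg x
    have h₂ := eval_sum_mul_nonneg hlam₁ hx
    rw [map_sub, map_sub, map_one] at h₁
    linarith
  · have h₁ := hsos₂.eval_nonneg x
    have h₂ := eval_sum_mul_nonneg hlam hx
    rw [map_add, map_sub, map_add, map_neg, eval_C] at h₁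
    rw [← hh x]
    linarith
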